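/- Let R be a W*-algebra with center Z, Δ the maximal ideal space of Z, and for t ∈ Δ let M_t be the unique maximal norm-closed two-sided ideal of R containing t. Let ω be a state on R of the form ω = μ∘φ, where μ = ω|Z and φ: R → Z is a unital positive Z-module map. If φ(M_t) ⊆ t for every t ∈ Δ, then ω is maximally mixed. In particular, every tracial state on R is maximally mixed. -/

import Mathlib

universe u

open scoped ComplexConjugate ComplexOrder

noncomputable section

variable {H : Type u} [NormedAddCommGroup H] [InnerProductSpace ℂ H] [CompleteSpace H]

local notation "⟪" x ", " y "⟫" => @inner ℂ _ _ x y

namespace VonNeumannAlgebraPaper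

/-- Scalar multiples of elements of a von Neumann algebra stay in it. -/
instance : SMulMemClass (VonNeumannAlgebra H) ℂ (H →L[ℂ] H) where
  smul_mem {S} z x hx := by
    have h : z • x = algebraMap ℂ (H →L[ℂ] H) z * x := Algebra.smul_def z x
    rw [h]
    exact mul_mem (S.toStarSubalgebra.algebraMap_mem z) hx

instance (M : VonNeumannAlgebra H) : Algebra ℂ ↥M :=
  Algebra.ofModule
    (fun r x y => Subtype.ext (smul_mul_assoc r (x : H →L[ℂ] H) (y : H →L[ℂ] H)))
    (fun r x y => Subtype.ext (mul_smul_comm r (x : H →L[ℂ] H) (y : H →L[ℂ] H)))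

instance (M : VonNeumannAlgebra H) : NormedAlgebra ℂ ↥M where
  norm_smul_le r x := norm_smul_le r (x : H →L[ℂ] H)

variable {M : VonNeumannAlgebra H}

/-- A linear functional on `M` is positive if it is nonnegative on all
elements `a* a`. -/
def IsPositiveFunctional (ω : ↥M →L[ℂ] ℂ) : Prop :=
  ∀ a : ↥M, 0 ≤ ω (star a * a)

/-- A state is a positive unital linear functional. -/
def IsState (ω : ↥M →L[ℂ] ℂ) : Prop :=
  IsPositiveFunctional ω ∧ ω 1 = 1

/-- A hermitian (self-adjoint) linear functional. -/
def IsHermitianFunctional (ω : ↥M →L[ℂ] ℂ) : Prop :=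
  ∀ a : ↥M, ω (star a) = conj (ω a)

/-- `ωp`, `ωm` form the Jordan decomposition of the hermitian functional `ω`. -/
def IsJordanDecomposition (ω ωp ωm : ↥M →L[ℂ] ℂ) : Prop :=
  IsPositiveFunctional ωp ∧ IsPositiveFunctional ωm ∧ ω = ωp - ωm ∧ ‖ω‖ = ‖ωp‖ + ‖ωm‖

/-- An element of a C*-algebra is positive iff it is of the form `b* b`. -/
def IsPositiveElem (c : ↥M) : Prop :=
  ∃ b : ↥M, c = star b * b

/-- A normal (= weak* continuous) functional on the von Neumann algebra `M`:
it is given by a pair of ℓ²-sequences of vectors. -/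
def IsNormalFunctional (ω : ↥M →L[ℂ] ℂ) : Prop :=
  ∃ x y : ℕ → H, Summable (fun n => ‖x n‖ ^ 2) ∧ Summable (fun n => ‖y n‖ ^ 2) ∧
    ∀ a : ↥M, HasSum (fun n => ⟪x n, (a : H →L[ℂ] H) (y n)⟫) (ω a)

/-- `E(M)`: the unital completely positive elementary maps
`x ↦ ∑ i, (a i)* x (a i)` with `∑ i, (a i)* (a i) = 1`. -/
def IsElementaryUCP (φ : ↥M →L[ℂ] ↥M) : Prop :=
  ∃ (n : ℕ) (a : Fin n → ↥M), (∑ i, star (a i) * a i) = 1 ∧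
    ∀ x : ↥M, φ x = ∑ i, star (a i) * x * a i

/-- The set `ω ∘ E(M) = {ω ∘ φ : φ ∈ E(M)}`. -/
def mixSet (ω : ↥M →L[ℂ] ℂ) : Set (↥M →L[ℂ] ℂ) :=
  {ρ | ∃ φ : ↥M →L[ℂ] ↥M, IsElementaryUCP φ ∧ ρ = ω.comp φ}

/-- Membership in the weak* closure of a set of functionals on `M`. -/
def InWeakStarClosure (S : Set (↥M →L[ℂ] ℂ)) (ρ : ↥M →L[ℂ] ℂ) : Prop :=
  ∀ ε : ℝ, 0 < ε → ∀ (n : ℕ) (x : Fin n → ↥M), ∃ σ ∈ S, ∀ i, ‖ρ (x i) - σ (x i)‖ < ε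

/-- Membership in the point-weak* closure of a set `S` of maps on `M`: at
finitely many points, finitely many normal functionals are simultaneously
approximated by some member of `S`. -/
def InPointWeakStarClosure (S : Set (↥M →L[ℂ] ↥M)) (ψ : ↥M →L[ℂ] ↥M) : Prop :=
  ∀ ε : ℝ, 0 < ε → ∀ (n : ℕ) (x : Fin n → ↥M) (g : Fin n → (↥M →L[ℂ] ℂ)),
    (∀ i, IsNormalFunctional (g i)) →
    ∃ φ ∈ S, ∀ i j, ‖g i (ψ (x j)) - g i (φ (x j))‖ < ε

/-- A map on `M` is normal if pre-composition preserves normal functionals. -/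
def IsNormalMap (ψ : ↥M →L[ℂ] ↥M) : Prop :=
  ∀ ω : ↥M →L[ℂ] ℂ, IsNormalFunctional ω → IsNormalFunctional (ω.comp ψ)

/-- Complete positivity of a map on `M`. -/
def IsCompletelyPositiveMap (ψ : ↥M →L[ℂ] ↥M) : Prop :=
  ∀ (n : ℕ) (a : Fin n → ↥M) (v : Fin n → H),
    0 ≤ ∑ i, ∑ j, ⟪v i, ((ψ (star (a i) * a j) : ↥M) : H →L[ℂ] H) (v j)⟫

/-- The norm `‖cω‖` of the functional `x ↦ ω (c * x)`. -/
def mulNorm (ω : ↥M →L[ℂ] ℂ) (c : ↥M) : ℝ :=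
  sSup {r : ℝ | ∃ x : ↥M, ‖x‖ ≤ 1 ∧ r = ‖ω (c * x)‖}

/-- Norm-closed two-sided ideals of `M`. -/
def IsClosedIdeal (J : Set ↥M) : Prop :=
  IsClosed J ∧ (0 : ↥M) ∈ J ∧ (∀ x ∈ J, ∀ y ∈ J, x + y ∈ J) ∧
    (∀ (c : ℂ), ∀ x ∈ J, c • x ∈ J) ∧ (∀ (a : ↥M), ∀ x ∈ J, a * x ∈ J ∧ x * a ∈ J)

/-- The norm `‖ω|J‖` of the restriction of a functional `ω` to a subset `J`. -/
def normRestrict (ω : ↥M →L[ℂ] ℂ) (J : Set ↥M) : ℝ :=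
  sSup {r : ℝ | ∃ x ∈ J, ‖x‖ ≤ 1 ∧ r = ‖ω x‖}

/-- Maximal (norm-closed two-sided) ideals of `M`. -/
def IsMaximalIdeal (N : Set ↥M) : Prop :=
  IsClosedIdeal N ∧ N ≠ Set.univ ∧
    ∀ N' : Set ↥M, IsClosedIdeal N' → N' ≠ Set.univ → N ⊆ N' → N' = N

/-- The strong radical of `M`: the intersection of all maximal ideals. -/
def strongRadical (M : VonNeumannAlgebra H) : Set ↥M :=
  ⋂₀ {N : Set ↥M | IsMaximalIdeal N}

/-- A state `ω` is maximally mixed if every state `ρ` in the weak* closure of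
`ω ∘ E(M)` satisfies in turn that `ω` is in the weak* closure of `ρ ∘ E(M)`. -/
def IsMaximallyMixed (ω : ↥M →L[ℂ] ℂ) : Prop :=
  IsState ω ∧ ∀ ρ : ↥M →L[ℂ] ℂ, IsState ρ →
    InWeakStarClosure (mixSet ω) ρ → InWeakStarClosure (mixSet ρ) ω

/-- `p` is a central projection of `M`. -/
def IsCentralProjection (p : ↥M) : Prop :=
  p ∈ Set.center ↥M ∧ IsSelfAdjoint p ∧ IsIdempotentElem p

/-- A projection `p` is finite if it is not Murray–von Neumann equivalent to a
proper subprojection of itself. -/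
def IsFiniteProjection (p : ↥M) : Prop :=
  IsSelfAdjoint p ∧ IsIdempotentElem p ∧
    ∀ v : ↥M, star v * v = p → p * (v * star v) = v * star v → v * star v = p

/-- `M` is properly infinite: it contains no nonzero finite central
projection. -/
def ProperlyInfinite (M : VonNeumannAlgebra H) : Prop :=
  ∀ p : ↥M, IsCentralProjection p → IsFiniteProjection p → p = 0

/-- An ideal of the center `Z` of `M` (a norm-closed subspace of the center,
stable under multiplication by central elements). -/
def IsCenterIdeal (t : Set ↥M) : Prop :=
  t ⊆ Set.center ↥M ∧ IsClosed t ∧ (0 : ↥M) ∈ t ∧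
    (∀ x ∈ t, ∀ y ∈ t, x + y ∈ t) ∧ (∀ (c : ℂ), ∀ x ∈ t, c • x ∈ t) ∧
    ∀ z ∈ Set.center ↥M, ∀ x ∈ t, z * x ∈ t

/-- A maximal ideal of the center `Z` of `M`, i.e. a point of the maximal ideal
space `Δ` of `Z`. -/
def IsMaxCenterIdeal (t : Set ↥M) : Prop :=
  IsCenterIdeal t ∧ t ≠ Set.center ↥M ∧
    ∀ s : Set ↥M, IsCenterIdeal s → s ≠ Set.center ↥M → t ⊆ s → s = t

section Helpers

section Abstract
variable {A : Type*} [CStarAlgebra A] [PartialOrder A] [StarOrderedRing A]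

theorem pc_aux_sqrt_conj (k : A) (hk : IsSelfAdjoint k) :
    0 ≤ CFC.sqrt k⁺ * k * CFC.sqrt k⁺ := by
  set g := CFC.sqrt k⁺ with hg
  have hg0 : 0 ≤ g := CFC.sqrt_nonneg _
  have hgs : star g = g := (IsSelfAdjoint.of_nonneg hg0).star_eq
  have hgg : g * g = k⁺ := CFC.sqrt_mul_sqrt_self _ (CFC.posPart_nonneg k)
  have hns : star k⁻ = k⁻ := (IsSelfAdjoint.of_nonneg (CFC.negPart_nonneg k)).star_eq
  have h0 : g * k⁻ = 0 := by
    rw [← CStarRing.star_mul_self_eq_zero_iff]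
    rw [star_mul, hgs, hns, mul_assoc, ← mul_assoc g g, hgg, CFC.posPart_mul_negPart, mul_zero]
  have hk' : k = k⁺ - k⁻ := (CFC.posPart_sub_negPart k hk).symm
  have : g * k * g = star (g) * k⁺ * g := by
    conv_lhs => rw [hk', mul_sub, h0, sub_zero]
    rw [hgs]
  rw [this]
  exact star_left_conjugate_nonneg (CFC.posPart_nonneg k) g

theorem sum_conj_ge {n : ℕ} (f : A) (hf : 0 ≤ f) (a b : Fin n → A)
    (hab : ∑ i, a i * f * b i = 1) :
    ∃ r : ℝ, 0 < r ∧ algebraMap ℝ A r ≤ ∑ i, star (b i) * f * b i := by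
  have hfs : star f = f := (IsSelfAdjoint.of_nonneg hf).star_eq
  set P := ∑ i, a i * f * star (a i) with hP
  set Q := ∑ i, star (b i) * f * b i with hQ
  have hP0 : 0 ≤ P := Finset.sum_nonneg fun i _ => star_right_conjugate_nonneg hf _
  obtain ⟨r, hr, hrP⟩ : ∃ r : ℝ, 0 < r ∧ r * ‖P‖ ≤ 1 := by
    refine ⟨1 / (‖P‖ + 1), by positivity, ?_⟩
    rw [one_div, inv_mul_le_iff₀ (by positivity)]; linarith
  have hPle : r • P ≤ 1 := by
    have h1 : P ≤ algebraMap ℝ A ‖P‖ := IsSelfAdjoint.le_algebraMap_norm_self (.of_nonneg hP0)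
    have h2 : r • P ≤ r • algebraMap ℝ A ‖P‖ := smul_le_smul_of_nonneg_left h1 hr.le
    refine h2.trans ?_
    rw [← algebraMap_smul A r, smul_eq_mul, ← map_mul, ← map_one (algebraMap ℝ A)]
    exact algebraMap_mono A hrP
  -- positivity of Σ (r a* - b)* f (r a* - b)
  have key : 0 ≤ ∑ i, star (r • star (a i) - b i) * f * (r • star (a i) - b i) :=
    Finset.sum_nonneg fun i _ => star_left_conjugate_nonneg hf _
  have hab' : ∑ i, star (b i) * f * star (a i) = 1 := by
    have := congrArg star hab
    rw [star_sum, star_one] at this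
    rw [← this]
    refine Finset.sum_congr rfl fun i _ => ?_
    simp [star_mul, hfs, mul_assoc]
  have hexp : ∑ i, star (r • star (a i) - b i) * f * (r • star (a i) - b i)
      = r • (r • P) - r • (1 : A) - r • (1 : A) + Q := by
    nth_rewrite 1 [← hab]
    rw [← hab', hP, hQ]
    simp only [Finset.smul_sum, ← Finset.sum_sub_distrib, ← Finset.sum_add_distrib]
    refine Finset.sum_congr rfl fun i _ => ?_
    simp only [star_sub, star_smul, star_star, star_trivial, sub_mul, mul_sub, smul_mul_assoc,
      mul_smul_comm, smul_sub]
    abel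
  refine ⟨r, hr, ?_⟩
  rw [hexp] at key
  have h3 : r • (r • P) ≤ r • (1 : A) := smul_le_smul_of_nonneg_left hPle hr.le
  rw [Algebra.algebraMap_eq_smul_one]
  have h4 : 0 ≤ r • (1:A) - r • (1 : A) - r • (1 : A) + Q :=
    key.trans (by gcongr)
  rw [sub_self, zero_sub, neg_add_eq_sub] at h4
  exact sub_nonneg.mp h4

theorem exists_ucp_nonneg {n : ℕ} (k : A) (hk : IsSelfAdjoint k) (a b : Fin n → A)
    (hab : ∑ i, a i * k⁺ * b i = 1) :
    ∃ c : Fin n → A, ∑ i, star (c i) * c i = 1 ∧ 0 ≤ ∑ i, star (c i) * k * c i := by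
  obtain ⟨r, hr, hle⟩ := sum_conj_ge k⁺ (CFC.posPart_nonneg k) a b hab
  set S := ∑ i, star (b i) * k⁺ * b i with hS
  set g := CFC.sqrt k⁺ with hg
  have hg0 : 0 ≤ g := CFC.sqrt_nonneg _
  have hgs : star g = g := (IsSelfAdjoint.of_nonneg hg0).star_eq
  have hgg : g * g = k⁺ := CFC.sqrt_mul_sqrt_self _ (CFC.posPart_nonneg k)
  have hrpos : IsStrictlyPositive (algebraMap ℝ A r) :=
    ⟨by rw [← map_zero (algebraMap ℝ A)]; exact algebraMap_mono A hr.le,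
      (isUnit_iff_ne_zero.mpr hr.ne').map (algebraMap ℝ A)⟩
  have hSpos : IsStrictlyPositive S := hrpos.of_le hle
  set T := S ^ (-(1 / 2) : ℝ) with hT
  have hT0 : 0 ≤ T := CFC.rpow_nonneg
  have hTs : star T = T := (IsSelfAdjoint.of_nonneg hT0).star_eq
  have hTST : T * S * T = 1 := CFC.conjugate_rpow_neg_one_half S hSpos
  refine ⟨fun i => g * b i * T, ?_, ?_⟩
  · rw [← hTST, hS, Finset.mul_sum, Finset.sum_mul]
    refine Finset.sum_congr rfl fun i _ => ?_
    rw [← hgg]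
    simp only [star_mul, hgs, hTs, mul_assoc]
  · refine Finset.sum_nonneg fun i _ => ?_
    have : star (g * b i * T) * k * (g * b i * T)
        = star (b i * T) * (g * k * g) * (b i * T) := by
      simp only [star_mul, hgs, hTs, mul_assoc]
    rw [this]
    exact star_left_conjugate_nonneg (pc_aux_sqrt_conj k hk) _

end Abstract

section GM
variable {A : Type*} [NormedRing A] [NormedAlgebra ℂ A] [CompleteSpace A]

/-- Gelfand-Mazur type lemma: a central element is a scalar modulo a closed proper two-sided
ideal in which every central element outside is invertible. -/
theorem gelfand_mazur_ideal (N : Submodule ℂ A) (hN : IsClosed (N : Set A))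
    (hl : ∀ a, ∀ x ∈ N, a * x ∈ N) (hr : ∀ a, ∀ x ∈ N, x * a ∈ N) (h1 : (1 : A) ∉ N)
    (z : A) (hz : ∀ a, z * a = a * z) :
    ∃ l : ℂ, ∀ r, 1 - (z - algebraMap ℂ A l) * r ∉ N := by
  have : IsClosed (N : Set A) := hN
  let L : A → (A ⧸ N →L[ℂ] A ⧸ N) := fun a =>
    N.liftQL ((N.mkQL).comp (ContinuousLinearMap.mul ℂ A a)) (by
      intro x hx
      simpa using hl a x hx)
  have hL : ∀ a x, L a (Submodule.Quotient.mk x) = Submodule.Quotient.mk (a * x) := by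
    intro a x; rfl
  have : Nontrivial (A ⧸ N) := by
    refine ⟨⟨Submodule.Quotient.mk 1, 0, ?_⟩⟩
    intro h
    exact h1 ((Submodule.Quotient.mk_eq_zero N).mp h)
  obtain ⟨l, hl'⟩ := spectrum.nonempty (L z)
  refine ⟨l, fun r hr' => ?_⟩
  rw [spectrum.mem_iff] at hl'
  apply hl'
  suffices h : IsUnit (L z - algebraMap ℂ _ l) by
    have h' := h.neg
    rwa [neg_sub] at h'
  have hLz : L z - algebraMap ℂ _ l = L (z - algebraMap ℂ A l) := by
    ext x
    obtain ⟨x, rfl⟩ := Submodule.Quotient.mk_surjective N x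
    rw [hL, sub_apply, hL, sub_mul, Submodule.Quotient.mk_sub]
    congr 1
    rw [Algebra.algebraMap_eq_smul_one, Algebra.algebraMap_eq_smul_one, smul_one_mul]
    rfl
  rw [hLz]
  set w := z - algebraMap ℂ A l with hw
  have hwc : ∀ a, w * a = a * w := by
    intro a
    rw [hw, sub_mul, mul_sub, hz, Algebra.commutes]
  have e1 : ∀ x : A, (Submodule.Quotient.mk (w * (r * x)) : A ⧸ N) = Submodule.Quotient.mk x := by
    intro x
    symm
    rw [Submodule.Quotient.eq]
    have := hr x _ hr'
    rwa [sub_mul, one_mul, mul_assoc] at this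
  refine ⟨⟨L w, L r, ?_, ?_⟩, rfl⟩
  · ext x
    obtain ⟨x, rfl⟩ := Submodule.Quotient.mk_surjective N x
    rw [mul_apply_eq_comp, hL, hL, e1]; rfl
  · ext x
    obtain ⟨x, rfl⟩ := Submodule.Quotient.mk_surjective N x
    rw [mul_apply_eq_comp, hL, hL, ← mul_assoc, ← hwc, mul_assoc, e1]; rfl

end GM

theorem isClosed_vN (M : VonNeumannAlgebra H) : IsClosed (M : Set (H →L[ℂ] H)) := by
  rw [← VonNeumannAlgebra.centralizer_centralizer M]
  exact Set.isClosed_centralizer _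

@[reducible] def instCStarVN (M : VonNeumannAlgebra H) : CStarAlgebra ↥M where
  toCompleteSpace := (isClosed_vN M).completeSpace_coe
  norm_mul_self_le x := CStarRing.norm_star_mul_self (x := (x : H →L[ℂ] H)) |>.symm.le
  star_smul r x := Subtype.ext (star_smul r (x : H →L[ℂ] H))

attribute [local instance] instCStarVN

theorem mem_of_commute {M : VonNeumannAlgebra H} {x : H →L[ℂ] H}
    (h : ∀ T ∈ M.commutant, T * x = x * T) : x ∈ M := by
  rw [← VonNeumannAlgebra.commutant_commutant M, VonNeumannAlgebra.mem_commutant_iff]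
  exact h

theorem instStarOrderedVN (M : VonNeumannAlgebra H) : StarOrderedRing ↥M :=
  StarOrderedRing.of_nonneg_iff' (fun {x y} hxy z => by
      have : (x : H →L[ℂ] H) ≤ y := hxy
      change (z : H →L[ℂ] H) + x ≤ z + y
      gcongr) (fun x => by
    constructor
    · intro hx
      have hx' : (0 : H →L[ℂ] H) ≤ x := hx
      have hmem : CFC.sqrt (x : H →L[ℂ] H) ∈ M := by
        apply mem_of_commute
        intro T hT
        have hc : Commute (x : H →L[ℂ] H) T :=
          VonNeumannAlgebra.mem_commutant_iff.mp hT x x.2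
        exact (hc.cfcₙ_nnreal _).symm.eq
      refine ⟨⟨_, hmem⟩, Subtype.ext ?_⟩
      change (x : H →L[ℂ] H) = star (CFC.sqrt (x : H →L[ℂ] H)) * CFC.sqrt (x : H →L[ℂ] H)
      rw [(IsSelfAdjoint.of_nonneg (CFC.sqrt_nonneg _)).star_eq, CFC.sqrt_mul_sqrt_self _ hx']
    · rintro ⟨s, rfl⟩
      exact star_mul_self_nonneg (s : H →L[ℂ] H))


attribute [local instance] instStarOrderedVN

/-- algebraic two-sided proper ideals -/
def IsPropIdeal (J : Set ↥M) : Prop :=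
  (1 : ↥M) ∉ J ∧ (0 : ↥M) ∈ J ∧ (∀ x ∈ J, ∀ y ∈ J, x + y ∈ J) ∧
    (∀ (a : ↥M), ∀ x ∈ J, a * x ∈ J ∧ x * a ∈ J)

theorem IsPropIdeal.smul {J : Set ↥M} (h : IsPropIdeal J) (c : ℂ) (x : ↥M) (hx : x ∈ J) :
    c • x ∈ J := by
  have := (h.2.2.2 (c • (1 : ↥M)) x hx).1
  rwa [smul_one_mul] at this

theorem IsClosedIdeal.prop {J : Set ↥M} (h : IsClosedIdeal J) (h1 : J ≠ Set.univ) :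
    IsPropIdeal J := by
  refine ⟨fun h1' => h1 ?_, h.2.1, h.2.2.1, h.2.2.2.2⟩
  ext x
  simpa using (h.2.2.2.2 x 1 h1').1

theorem IsPropIdeal.closure {J : Set ↥M} (h : IsPropIdeal J) : IsPropIdeal (closure J) := by
  refine ⟨?_, subset_closure h.2.1, ?_, ?_⟩
  · intro h1
    rw [Metric.mem_closure_iff] at h1
    obtain ⟨b, hb, hd⟩ := h1 1 one_pos
    rw [dist_eq_norm] at hd
    have hu : IsUnit b := by
      have := isUnit_one_sub_of_norm_lt_one hd
      simpa using this
    obtain ⟨u, rfl⟩ := hu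
    apply h.1
    have := (h.2.2.2 (↑u⁻¹) _ hb).1
    simpa using this
  · intro x hx y hy
    exact map_mem_closure₂ continuous_add hx hy (fun a ha b hb => h.2.2.1 a ha b hb)
  · intro a x hx
    constructor
    · exact map_mem_closure (continuous_const_mul a) hx (fun y hy => (h.2.2.2 a y hy).1)
    · exact map_mem_closure (f := fun y => y * a) (continuous_mul_const a) hx (fun y hy => (h.2.2.2 a y hy).2)

theorem IsPropIdeal.isClosedIdeal {J : Set ↥M} (h : IsPropIdeal J) (hc : IsClosed J) :
    IsClosedIdeal J :=
  ⟨hc, h.2.1, h.2.2.1, h.smul, h.2.2.2⟩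

theorem IsPropIdeal.exists_maximal {J : Set ↥M} (h : IsPropIdeal J) :
    ∃ N : Set ↥M, IsMaximalIdeal N ∧ J ⊆ N ∧ IsPropIdeal N ∧
      ∀ N', IsPropIdeal N' → N ⊆ N' → N' = N := by
  obtain ⟨N, hJN, hN⟩ := zorn_subset_nonempty {N : Set ↥M | IsPropIdeal N} (by
    intro c hc hch hne
    refine ⟨⋃₀ c, ⟨?_, ?_, ?_, ?_⟩, fun s hs => Set.subset_sUnion_of_mem hs⟩
    · rintro ⟨s, hs, h1⟩
      exact (hc hs).1 h1
    · obtain ⟨s, hs⟩ := hne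
      exact ⟨s, hs, (hc hs).2.1⟩
    · rintro x ⟨s, hs, hx⟩ y ⟨s', hs', hy⟩
      rcases hch.total hs hs' with hle | hle
      · exact ⟨s', hs', (hc hs').2.2.1 x (hle hx) y hy⟩
      · exact ⟨s, hs, (hc hs).2.2.1 x hx y (hle hy)⟩
    · rintro a x ⟨s, hs, hx⟩
      exact ⟨⟨s, hs, ((hc hs).2.2.2 a x hx).1⟩, ⟨s, hs, ((hc hs).2.2.2 a x hx).2⟩⟩) J h
  have hNp : IsPropIdeal N := hN.prop
  have hmax : ∀ N', IsPropIdeal N' → N ⊆ N' → N' = N := fun N' hN' hle =>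
    (hN.eq_of_subset hN' hle).symm
  have hcl : _root_.closure N = N := hmax _ hNp.closure subset_closure
  have hclosed : IsClosed N := closure_eq_iff_isClosed.mp hcl
  refine ⟨N, ⟨hNp.isClosedIdeal hclosed, ?_, ?_⟩, hJN, hNp, hmax⟩
  · intro hu
    exact hNp.1 (hu ▸ Set.mem_univ _)
  · intro N' hN' hne hle
    exact hmax N' (hN'.prop hne) hle

/-- sums `∑ a_i f b_i` -/
def genIdeal (f : ↥M) : Set ↥M :=
  {x | ∃ (n : ℕ) (a b : Fin n → ↥M), ∑ i, a i * f * b i = x}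

theorem genIdeal_prop (f : ↥M) (h1 : (1 : ↥M) ∉ genIdeal f) : IsPropIdeal (genIdeal f) := by
  refine ⟨h1, ⟨0, Fin.elim0, Fin.elim0, by simp⟩, ?_, ?_⟩
  · rintro x ⟨n, a, b, rfl⟩ y ⟨m, a', b', rfl⟩
    refine ⟨n + m, Fin.append a a', Fin.append b b', ?_⟩
    simp [Fin.sum_univ_add]
  · rintro c x ⟨n, a, b, rfl⟩
    refine ⟨⟨n, fun i => c * a i, b, ?_⟩, ⟨n, a, fun i => b i * c, ?_⟩⟩
    · simp [Finset.mul_sum, mul_assoc]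
    · simp [Finset.sum_mul, mul_assoc]

theorem mem_genIdeal (f : ↥M) : f ∈ genIdeal f :=
  ⟨1, fun _ => 1, fun _ => 1, by simp⟩

theorem mem_center_iff' {z : ↥M} : z ∈ Set.center ↥M ↔ ∀ a, z * a = a * z := by
  rw [Semigroup.mem_center_iff]
  exact forall_congr' fun a => eq_comm

theorem center_inter_max (N : Set ↥M) (hN : IsMaximalIdeal N) (hNp : IsPropIdeal N)
    (hmax : ∀ N', IsPropIdeal N' → N ⊆ N' → N' = N) :
    IsMaxCenterIdeal (N ∩ Set.center ↥M) := by
  have hcc : IsClosed (Set.center ↥M) := by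
    rw [← Set.centralizer_univ]
    exact Set.isClosed_centralizer _
  have h1c : (1 : ↥M) ∈ Set.center ↥M := Set.one_mem_center
  have hsc : ∀ (c : ℂ), ∀ x ∈ Set.center ↥M, c • x ∈ Set.center ↥M := by
    intro c x hx
    rw [mem_center_iff'] at hx ⊢
    intro a
    rw [smul_mul_assoc, hx, mul_smul_comm]
  refine ⟨⟨Set.inter_subset_right, hN.1.1.inter hcc, ⟨hNp.2.1, Set.zero_mem_center⟩, ?_, ?_, ?_⟩,
    ?_, ?_⟩
  · rintro x ⟨hx, hx'⟩ y ⟨hy, hy'⟩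
    exact ⟨hNp.2.2.1 x hx y hy, Set.add_mem_center hx' hy'⟩
  · rintro c x ⟨hx, hx'⟩
    exact ⟨hNp.smul c x hx, hsc c x hx'⟩
  · rintro z hz x ⟨hx, hx'⟩
    exact ⟨(hNp.2.2.2 z x hx).1, Set.mul_mem_center hz hx'⟩
  · intro h
    have : (1 : ↥M) ∈ N ∩ Set.center ↥M := by rw [h]; exact h1c
    exact hNp.1 this.1
  · intro s hs hne hsub
    refine Set.Subset.antisymm ?_ hsub
    intro z hz
    have hzc : z ∈ Set.center ↥M := hs.1 hz
    refine ⟨?_, hzc⟩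
    by_contra hzN
    let NS : Submodule ℂ ↥M :=
      { carrier := N
        add_mem' := fun {a b} ha hb => hNp.2.2.1 a ha b hb
        zero_mem' := hNp.2.1
        smul_mem' := fun c x hx => hNp.smul c x hx }
    obtain ⟨l, hl⟩ := gelfand_mazur_ideal NS hN.1.1 (fun a x hx => (hNp.2.2.2 a x hx).1)
      (fun a x hx => (hNp.2.2.2 a x hx).2) hNp.1 z (mem_center_iff'.mp hzc)
    set w := z - algebraMap ℂ ↥M l with hw
    have hwc : ∀ a, w * a = a * w := by
      intro a
      rw [hw, sub_mul, mul_sub, mem_center_iff'.mp hzc, Algebra.commutes]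
    -- w ∈ N
    have hwN : w ∈ N := by
      have hP : IsPropIdeal {x : ↥M | ∃ r, x - w * r ∈ N} := by
        refine ⟨?_, ⟨0, by simpa using hNp.2.1⟩, ?_, ?_⟩
        · rintro ⟨r, hr⟩
          exact hl r hr
        · rintro x ⟨r, hr⟩ y ⟨r', hr'⟩
          refine ⟨r + r', ?_⟩
          have := hNp.2.2.1 _ hr _ hr'
          convert this using 1
          rw [mul_add]; abel
        · rintro a x ⟨r, hr⟩
          refine ⟨⟨a * r, ?_⟩, ⟨r * a, ?_⟩⟩
          · have := (hNp.2.2.2 a _ hr).1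
            rwa [mul_sub, ← mul_assoc a w r, ← hwc, mul_assoc] at this
          · have := (hNp.2.2.2 a _ hr).2
            rwa [sub_mul, mul_assoc] at this
      have := hmax _ hP (fun x hx => ⟨0, by simpa using hx⟩)
      rw [← this]
      exact ⟨1, by simpa using hNp.2.1⟩
    have hl0 : l ≠ 0 := by
      rintro rfl
      apply hzN
      simpa [hw] using hwN
    have hws : w ∈ s := hsub ⟨hwN, mem_center_iff'.mpr hwc⟩
    have h1s : (1 : ↥M) ∈ s := by
      have h2 : z + (-1 : ℂ) • w ∈ s := hs.2.2.2.1 _ hz _ (hs.2.2.2.2.1 _ _ hws)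
      have h3 : z + (-1 : ℂ) • w = l • 1 := by
        rw [hw, Algebra.algebraMap_eq_smul_one, neg_smul, one_smul]; abel
      rw [h3] at h2
      have h4 := hs.2.2.2.2.1 l⁻¹ _ h2
      rwa [smul_smul, inv_mul_cancel₀ hl0, one_smul] at h4
    apply hne
    refine Set.Subset.antisymm hs.1 ?_
    intro y hy
    have := hs.2.2.2.2.2 y hy 1 h1s
    rwa [mul_one] at this

/-- The elementary map `x ↦ ∑ a_i* x a_i`. -/
def elemMap {n : ℕ} (a : Fin n → ↥M) : ↥M →L[ℂ] ↥M :=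
  ∑ i, ContinuousLinearMap.mulLeftRight ℂ ↥M (star (a i)) (a i)

theorem elemMap_apply {n : ℕ} (a : Fin n → ↥M) (x : ↥M) :
    elemMap a x = ∑ i, star (a i) * x * a i := by
  simp [elemMap]

theorem elemMap_ucp {n : ℕ} (a : Fin n → ↥M) (h : ∑ i, star (a i) * a i = 1) :
    IsElementaryUCP (elemMap a) := ⟨n, a, h, elemMap_apply a⟩

theorem IsElementaryUCP.center {ψ : ↥M →L[ℂ] ↥M} (h : IsElementaryUCP ψ) {z : ↥M}
    (hz : z ∈ Set.center ↥M) : ψ z = z := by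
  obtain ⟨n, a, h1, ha⟩ := h
  rw [ha]
  have : ∀ i, star (a i) * z * a i = z * (star (a i) * a i) := by
    intro i
    rw [← mem_center_iff'.mp hz, mul_assoc]
  simp_rw [this]
  rw [← Finset.mul_sum, h1, mul_one]

theorem IsElementaryUCP.comp {ψ χ : ↥M →L[ℂ] ↥M} (h : IsElementaryUCP ψ)
    (h' : IsElementaryUCP χ) : IsElementaryUCP (ψ.comp χ) := by
  obtain ⟨n, a, h1, ha⟩ := h
  obtain ⟨m, b, h1', hb⟩ := h'
  refine ⟨n * m, fun k => b (finProdFinEquiv.symm k).2 * a (finProdFinEquiv.symm k).1, ?_, ?_⟩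
  · rw [Equiv.sum_comp finProdFinEquiv.symm (fun p : Fin n × Fin m =>
      star (b p.2 * a p.1) * (b p.2 * a p.1)), Fintype.sum_prod_type]
    rw [← h1]
    refine Finset.sum_congr rfl fun i _ => ?_
    calc ∑ j, star (b j * a i) * (b j * a i) = star (a i) * (∑ j, star (b j) * b j) * a i := by
          simp [Finset.mul_sum, Finset.sum_mul, mul_assoc]
      _ = _ := by rw [h1', mul_one]
  · intro x
    rw [Equiv.sum_comp finProdFinEquiv.symm (fun p : Fin n × Fin m =>
      star (b p.2 * a p.1) * x * (b p.2 * a p.1)), Fintype.sum_prod_type]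
    rw [ContinuousLinearMap.comp_apply, ha, hb]
    refine Finset.sum_congr rfl fun i _ => ?_
    simp [Finset.mul_sum, Finset.sum_mul, mul_assoc]

theorem IsElementaryUCP.convex {ψ χ : ↥M →L[ℂ] ↥M} (h : IsElementaryUCP ψ)
    (h' : IsElementaryUCP χ) {s t : ℝ} (hs : 0 ≤ s) (ht : 0 ≤ t) (hst : s + t = 1) :
    IsElementaryUCP ((s : ℂ) • ψ + (t : ℂ) • χ) := by
  obtain ⟨n, a, h1, ha⟩ := h
  obtain ⟨m, b, h1', hb⟩ := h'
  have key : ∀ (r : ℝ) (hr : 0 ≤ r) (y x : ↥M),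
      star ((Real.sqrt r : ℂ) • y) * x * ((Real.sqrt r : ℂ) • y) = (r : ℂ) • (star y * x * y) := by
    intro r hr y x
    rw [star_smul, smul_mul_assoc, smul_mul_assoc, mul_smul_comm, smul_smul]
    congr 1
    rw [Complex.star_def, Complex.conj_ofReal, ← Complex.ofReal_mul, Real.mul_self_sqrt hr]
  have key' : ∀ (r : ℝ) (hr : 0 ≤ r) (y : ↥M),
      star ((Real.sqrt r : ℂ) • y) * ((Real.sqrt r : ℂ) • y) = (r : ℂ) • (star y * y) := by
    intro r hr y
    have := key r hr y 1
    simpa using this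
  refine ⟨n + m, Fin.append (fun i => (Real.sqrt s : ℂ) • a i) (fun i => (Real.sqrt t : ℂ) • b i),
    ?_, ?_⟩
  · rw [Fin.sum_univ_add]
    simp only [Fin.append_left, Fin.append_right, key' s hs, key' t ht]
    rw [← Finset.smul_sum, ← Finset.smul_sum, h1, h1', ← add_smul, ← Complex.ofReal_add, hst,
      Complex.ofReal_one, one_smul]
  · intro x
    rw [Fin.sum_univ_add]
    simp only [Fin.append_left, Fin.append_right, key s hs, key t ht]
    rw [← Finset.smul_sum, ← Finset.smul_sum, ← ha, ← hb]
    rfl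

theorem IsElementaryUCP.star {ψ : ↥M →L[ℂ] ↥M} (h : IsElementaryUCP ψ) {k : ↥M}
    (hk : IsSelfAdjoint k) : IsSelfAdjoint (ψ k) := by
  obtain ⟨n, a, h1, ha⟩ := h
  rw [ha, IsSelfAdjoint, star_sum]
  refine Finset.sum_congr rfl fun i _ => ?_
  simp [star_mul, hk.star_eq, mul_assoc]

theorem IsElementaryUCP.isState {ψ : ↥M →L[ℂ] ↥M} (h : IsElementaryUCP ψ)
    {ρ : ↥M →L[ℂ] ℂ} (hρ : IsState ρ) : IsState (ρ.comp ψ) := by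
  have h2 := h.center (Set.one_mem_center (M := ↥M))
  obtain ⟨n, a, h1, ha⟩ := h
  refine ⟨fun b => ?_, ?_⟩
  · rw [ContinuousLinearMap.comp_apply, ha, map_sum]
    refine Finset.sum_nonneg fun i _ => ?_
    have := hρ.1 (b * a i)
    simpa [star_mul, mul_assoc] using this
  · rw [ContinuousLinearMap.comp_apply, h2, hρ.2]

theorem IsState.nonneg {ρ : ↥M →L[ℂ] ℂ} (hρ : IsState ρ) {x : ↥M} (hx : 0 ≤ x) : 0 ≤ ρ x := by
  obtain ⟨b, rfl⟩ := CStarAlgebra.nonneg_iff_eq_star_mul_self.mp hx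
  exact hρ.1 b

theorem IsState.im_eq_zero {ρ : ↥M →L[ℂ] ℂ} (hρ : IsState ρ) {x : ↥M} (hx : IsSelfAdjoint x) :
    (ρ x).im = 0 := by
  rw [← CFC.posPart_sub_negPart x hx, map_sub, Complex.sub_im]
  have h1 := (Complex.nonneg_iff.mp (hρ.nonneg (CFC.posPart_nonneg x))).2
  have h2 := (Complex.nonneg_iff.mp (hρ.nonneg (CFC.negPart_nonneg x))).2
  rw [← h1, ← h2, sub_zero]

theorem IsState.re_realPart {ρ : ↥M →L[ℂ] ℂ} (hρ : IsState ρ) (y : ↥M) :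
    (ρ y).re = (ρ (realPart y : ↥M)).re := by
  conv_lhs => rw [← realPart_add_I_smul_imaginaryPart y]
  rw [map_add, map_smul, Complex.add_re, smul_eq_mul, Complex.I_mul_re,
    hρ.im_eq_zero (imaginaryPart y).2]
  simp

theorem inClosure_of_sep (ρ ω : ↥M →L[ℂ] ℂ) (hρ : IsState ρ) (hω : IsState ω)
    (h : ∀ k : ↥M, IsSelfAdjoint k → ∀ ε : ℝ, 0 < ε →
      ∃ ψ : ↥M →L[ℂ] ↥M, IsElementaryUCP ψ ∧ (ω k).re ≤ (ρ (ψ k)).re + ε) :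
    InWeakStarClosure (mixSet ρ) ω := by
  intro ε hε n x
  set C : Set (Fin n → ℂ) := {v | ∃ ψ : ↥M →L[ℂ] ↥M, IsElementaryUCP ψ ∧
    v = fun i => ρ (ψ (x i))} with hC
  set w : Fin n → ℂ := fun i => ω (x i) with hw
  have hconv : Convex ℝ C := by
    rintro v ⟨ψ, hψ, rfl⟩ v' ⟨χ, hχ, rfl⟩ s t hs ht hst
    refine ⟨_, hψ.convex hχ hs ht hst, ?_⟩
    ext i
    simp
  have hmem : w ∈ closure C := by
    by_contra hwC
    obtain ⟨f, c, hf1, hf2⟩ := RCLike.geometric_hahn_banach_closed_point (𝕜 := ℂ)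
      hconv.closure isClosed_closure hwC
    have hfe : ∀ σ : ↥M →L[ℂ] ℂ, f (fun i => σ (x i)) =
        σ (∑ i, f (Pi.single i 1) • x i) := by
      intro σ
      have : (fun i => σ (x i)) = ∑ i, σ (x i) • (Pi.single i (1 : ℂ) : Fin n → ℂ) := by
        ext j
        simp [Finset.sum_apply, Pi.single_apply]
      rw [this, map_sum, map_sum]
      refine Finset.sum_congr rfl fun i _ => ?_
      rw [map_smul, map_smul, smul_eq_mul, smul_eq_mul, mul_comm]
    set y := ∑ i, f (Pi.single i 1) • x i with hy
    rw [hw, hfe ω] at hf2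
    obtain ⟨ψ, hψ, hle⟩ := h (realPart y : ↥M) (realPart y).2 (((ω y).re - c) / 2) (by
      have : c < (ω y).re := hf2
      linarith)
    have h3 := hf1 (fun i => ρ (ψ (x i))) (subset_closure ⟨ψ, hψ, rfl⟩)
    have h4 : f (fun i => ρ (ψ (x i))) = (ρ.comp ψ) y := hfe (ρ.comp ψ)
    rw [h4] at h3
    have h5 : ((ρ.comp ψ) y).re < c := h3
    rw [(hψ.isState hρ).re_realPart] at h5
    have h6 : c < (ω y).re := hf2
    rw [hω.re_realPart y] at hle h6
    have h7 : (ρ (ψ (realPart y : ↥M))).re < c := h5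
    linarith
  rw [Metric.mem_closure_iff] at hmem
  obtain ⟨v, ⟨ψ, hψ, rfl⟩, hd⟩ := hmem ε hε
  refine ⟨ρ.comp ψ, ⟨ψ, hψ, rfl⟩, fun i => ?_⟩
  rw [dist_pi_lt_iff hε] at hd
  have := hd i
  rwa [dist_eq_norm] at this

theorem eq_on_center {ω ρ : ↥M →L[ℂ] ℂ} (h : InWeakStarClosure (mixSet ω) ρ) {z : ↥M}
    (hz : z ∈ Set.center ↥M) : ρ z = ω z := by
  by_contra hne
  have hpos : 0 < ‖ρ z - ω z‖ := norm_pos_iff.mpr (sub_ne_zero.mpr hne)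
  obtain ⟨σ, ⟨ψ, hψ, rfl⟩, hσ⟩ := h _ hpos 1 (fun _ => z)
  have := hσ 0
  rw [ContinuousLinearMap.comp_apply, hψ.center hz] at this
  exact lt_irrefl _ this

theorem part_one
    (ω : ↥M →L[ℂ] ℂ) (hω : IsState ω)
    (φ : ↥M →L[ℂ] ↥M)
    (hrange : ∀ x : ↥M, φ x ∈ Set.center ↥M)
    (hpos : ∀ a : ↥M, ∃ b : ↥M, φ (star a * a) = star b * b)
    (hone : φ 1 = 1)
    (hmod : ∀ z ∈ Set.center ↥M, ∀ x : ↥M, φ (z * x) = z * φ x)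
    (hfactor : ∀ x : ↥M, ω x = ω (φ x))
    (ht : ∀ t Mt : Set ↥M, IsMaxCenterIdeal t → IsMaximalIdeal Mt → t ⊆ Mt →
      ∀ x ∈ Mt, φ x ∈ t) :
    IsMaximallyMixed ω := by
  refine ⟨hω, fun ρ hρ hcl => inClosure_of_sep ρ ω hρ hω fun h hh ε hε => ?_⟩
  have hφ0 : ∀ x : ↥M, 0 ≤ x → 0 ≤ φ x := by
    intro x hx
    obtain ⟨b, rfl⟩ := CStarAlgebra.nonneg_iff_eq_star_mul_self.mp hx
    obtain ⟨c, hc⟩ := hpos b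
    rw [hc]; exact star_mul_self_nonneg c
  have hφs : IsSelfAdjoint (φ h) := by
    rw [← CFC.posPart_sub_negPart h hh, map_sub]
    exact (IsSelfAdjoint.of_nonneg (hφ0 _ (CFC.posPart_nonneg h))).sub
      (IsSelfAdjoint.of_nonneg (hφ0 _ (CFC.negPart_nonneg h)))
  set k : ↥M := h - φ h + algebraMap ℝ ↥M ε with hk
  have hεs : IsSelfAdjoint (algebraMap ℝ ↥M ε) := IsSelfAdjoint.algebraMap _ (.all ε)
  have hks : IsSelfAdjoint k := (hh.sub hφs).add hεs
  have hεc : algebraMap ℝ ↥M ε ∈ Set.center ↥M := by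
    rw [mem_center_iff']; intro a; exact Algebra.commutes _ _
  have hφc : ∀ z ∈ Set.center ↥M, φ z = z := by
    intro z hz
    have := hmod z hz 1
    rwa [mul_one, hone, mul_one] at this
  have hφk : φ k = algebraMap ℝ ↥M ε := by
    rw [hk, map_add, map_sub, hφc _ (hrange h), hφc _ hεc, sub_self, zero_add]
  have hεpos : IsStrictlyPositive (algebraMap ℝ ↥M ε) :=
    ⟨by rw [← map_zero (algebraMap ℝ ↥M)]; exact algebraMap_mono ↥M hε.le,
      (isUnit_iff_ne_zero.mpr hε.ne').map (algebraMap ℝ ↥M)⟩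
  have hge : algebraMap ℝ ↥M ε ≤ φ k⁺ := by
    have h1 : φ k⁺ = φ k + φ k⁻ := by
      rw [← map_add]; congr 1
      rw [← sub_eq_iff_eq_add]; exact CFC.posPart_sub_negPart k hks
    rw [h1, hφk]
    exact le_add_of_nonneg_right (hφ0 _ (CFC.negPart_nonneg k))
  have hunit : IsUnit (φ k⁺) := CStarAlgebra.isUnit_of_le _ hge hεpos
  have h1 : (1 : ↥M) ∈ genIdeal k⁺ := by
    by_contra hn
    obtain ⟨N, hN, hJN, hNp, hmax⟩ := (genIdeal_prop k⁺ hn).exists_maximal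
    have h2 := ht _ N (center_inter_max N hN hNp hmax) hN Set.inter_subset_left k⁺
      (hJN (mem_genIdeal _))
    obtain ⟨u, hu⟩ := hunit
    rw [← hu] at h2
    have h3 := (hNp.2.2.2 (↑u⁻¹) _ h2.1).1
    rw [Units.inv_mul] at h3
    exact hNp.1 h3
  obtain ⟨n, a, b, hab⟩ := h1
  obtain ⟨c, hc1, hc2⟩ := exists_ucp_nonneg k hks a b hab
  refine ⟨elemMap c, elemMap_ucp c hc1, ?_⟩
  rw [← elemMap_apply, hk, map_add, map_sub, (elemMap_ucp c hc1).center (hrange h),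
    (elemMap_ucp c hc1).center hεc] at hc2
  have h4 := (Complex.nonneg_iff.mp (hρ.nonneg hc2)).1
  have h5 : ρ (algebraMap ℝ ↥M ε) = ε := by
    rw [Algebra.algebraMap_eq_smul_one]
    have : (ε • (1 : ↥M)) = (ε : ℂ) • (1 : ↥M) := rfl
    rw [this, map_smul, hρ.2, smul_eq_mul, mul_one]
  rw [map_add, map_sub, h5, eq_on_center hcl (hrange h), ← hfactor] at h4
  simp only [Complex.add_re, Complex.sub_re, Complex.ofReal_re] at h4
  linarith

theorem exists_proj (K : Submodule ℂ H) (hK : IsClosed (K : Set H))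
    (h : ∀ T ∈ M.commutant, ∀ x ∈ K, T x ∈ K) :
    ∃ p : ↥M, star p = p ∧ p * p = p ∧ (∀ x ∈ K, (p : H →L[ℂ] H) x = x) ∧
      ∀ x, (p : H →L[ℂ] H) x ∈ K := by
  have : CompleteSpace K := hK.completeSpace_coe
  have hs : IsStarProjection K.starProjection := isStarProjection_starProjection
  have hm : K.starProjection ∈ M := by
    rw [VonNeumannAlgebra.IsStarProjection.mem_iff hs]
    intro y hy
    rw [Submodule.range_starProjection]
    exact fun x hx => h y hy x hx
  refine ⟨⟨_, hm⟩, Subtype.ext hs.isSelfAdjoint, Subtype.ext hs.isIdempotentElem, ?_, ?_⟩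
  · intro x hx
    exact Submodule.starProjection_eq_self_iff.mpr hx
  · intro x
    exact Submodule.starProjection_apply_mem _ _

theorem vN_commute (x : ↥M) {T : H →L[ℂ] H} (hT : T ∈ M.commutant) (ξ : H) :
    T ((x : H →L[ℂ] H) ξ) = (x : H →L[ℂ] H) (T ξ) := by
  have := VonNeumannAlgebra.mem_commutant_iff.mp hT x x.2
  exact congrArg (fun S : H →L[ℂ] H => S ξ) this.symm

theorem star_mul_self_le_of {A : Type*} [CStarAlgebra A] [PartialOrder A] [StarOrderedRing A]
    {p x : A} (hp : star p = p) (hpp : p * p = p) (hx : x ≤ 1) : p * x * p ≤ p := by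
  have := star_left_conjugate_le_conjugate hx p
  rwa [hp, mul_one, hpp] at this

/-- Spectral cut at zero. -/
theorem exists_cut (h : ↥M) (hh : IsSelfAdjoint h) (hn : ‖h‖ ≤ 1) :
    ∃ p : ↥M, star p = p ∧ p * p = p ∧ h ≤ p ∧ -(1 - p) ≤ h := by
  obtain ⟨k, n, hk, hn0, hkn, hnk⟩ : ∃ k n : ↥M, 0 ≤ k ∧ 0 ≤ n ∧ k - n = h ∧ n * k = 0 :=
    ⟨h⁺, h⁻, CFC.posPart_nonneg h, CFC.negPart_nonneg h, CFC.posPart_sub_negPart h hh,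
      CFC.negPart_mul_posPart h⟩
  obtain ⟨p, hp, hpp, hp1, hp2⟩ := exists_proj (M := M) ((n : H →L[ℂ] H).ker)
    (n : H →L[ℂ] H).isClosed_ker (by
      intro T hT x hx
      have hx' : (n : H →L[ℂ] H) x = 0 := hx
      change (n : H →L[ℂ] H) (T x) = 0
      rw [← vN_commute n hT, hx', map_zero])
  have hks := hk.isSelfAdjoint.star_eq
  have hns := hn0.isSelfAdjoint.star_eq
  have h1 : n * p = 0 := Subtype.ext (ContinuousLinearMap.ext fun x => hp2 x)
  have h2 : p * k = k := Subtype.ext (ContinuousLinearMap.ext fun x =>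
    hp1 _ (congrArg (fun S : ↥M => (S : H →L[ℂ] H) x) hnk))
  have h1' : p * n = 0 := by simpa [hp, hns] using congrArg star h1
  have h2' : k * p = k := by simpa [hp, hks] using congrArg star h2
  have hle : h ≤ 1 := by
    refine hh.le_algebraMap_norm_self.trans ?_
    rw [← map_one (algebraMap ℝ ↥M)]
    exact algebraMap_mono _ hn
  have hge : -h ≤ 1 := by
    have := hh.neg.le_algebraMap_norm_self
    rw [norm_neg] at this
    refine this.trans ?_
    rw [← map_one (algebraMap ℝ ↥M)]
    exact algebraMap_mono _ hn
  refine ⟨p, hp, hpp, ?_, ?_⟩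
  · have e : p * h * p = k := by
      rw [← hkn, mul_sub, sub_mul, h2, h2', h1', zero_mul, sub_zero]
    have := star_mul_self_le_of hp hpp hle
    rw [e] at this
    refine le_trans ?_ this
    rw [← hkn]
    exact sub_le_self _ hn0
  · have e : (1 - p) * (-h) * (1 - p) = n := by
      rw [← hkn]
      simp only [mul_sub, sub_mul, mul_neg, neg_mul, one_mul, mul_one, h1, h1', h2, h2', zero_mul]
      abel
    have hq : star (1 - p) = 1 - p := by simp [hp]
    have hqq : (1 - p) * (1 - p) = 1 - p := by
      simp [mul_sub, sub_mul, hpp]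
    have := star_mul_self_le_of hq hqq hge
    rw [e] at this
    rw [← hkn]
    have h3 : -(1 - p) ≤ -n := neg_le_neg this
    refine h3.trans ?_
    rw [sub_eq_add_neg]
    exact le_add_of_nonneg_left hk

/-- If `q M p = 0` then `p` and `q` are separated by a central projection. -/
theorem exists_central (p q : ↥M) (h : ∀ x : ↥M, q * x * p = 0) :
    ∃ e : ↥M, e ∈ Set.center ↥M ∧ star e = e ∧ e * e = e ∧ e * p = p ∧ q * e = 0 := by
  let S : Set H := {y | ∃ x : ↥M, ∃ ξ : H, y = ((x * p : ↥M) : H →L[ℂ] H) ξ}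
  let K : Submodule ℂ H := (Submodule.span ℂ S).topologicalClosure
  have hcl : IsClosed (K : Set H) := Submodule.isClosed_topologicalClosure _
  have hSK : S ⊆ K := Submodule.subset_span.trans (Submodule.le_topologicalClosure _)
  have key : ∀ (T : H →L[ℂ] H) (L : Submodule ℂ H), IsClosed (L : Set H) →
      (∀ y ∈ S, T y ∈ L) → ∀ y ∈ K, T y ∈ L := by
    intro T L hL hS
    have h1 : Submodule.span ℂ S ≤ L.comap (T : H →ₗ[ℂ] H) := Submodule.span_le.mpr hS
    exact Submodule.topologicalClosure_minimal _ h1 (hL.preimage T.continuous)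
  have hM' : ∀ T ∈ M.commutant, ∀ y ∈ K, T y ∈ K := by
    intro T hT
    refine key T K hcl ?_
    rintro _ ⟨x, ξ, rfl⟩
    rw [vN_commute _ hT]
    exact hSK ⟨x, T ξ, rfl⟩
  have hM : ∀ a : ↥M, ∀ y ∈ K, (a : H →L[ℂ] H) y ∈ K := by
    intro a
    refine key _ K hcl ?_
    rintro _ ⟨x, ξ, rfl⟩
    refine hSK ⟨a * x, ξ, ?_⟩
    rw [mul_assoc]; rfl
  obtain ⟨e, he, hee, he1, he2⟩ := exists_proj (M := M) K hcl hM'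
  have hae : ∀ a : ↥M, e * a * e = a * e := fun a =>
    Subtype.ext (ContinuousLinearMap.ext fun x => he1 _ (hM a _ (he2 x)))
  refine ⟨e, ?_, he, hee, ?_, ?_⟩
  · rw [mem_center_iff']
    intro a
    have h1 := hae a
    have h2 := congrArg star (hae (star a))
    simp only [star_mul, star_star, he] at h2
    rw [← h2, ← mul_assoc, h1]
  · refine Subtype.ext (ContinuousLinearMap.ext fun x => he1 _ (hSK ⟨1, x, ?_⟩))
    rw [one_mul]; rfl
  · refine Subtype.ext (ContinuousLinearMap.ext fun x => ?_)
    have := key (q : H →L[ℂ] H) ⊥ (by simp) (by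
      rintro _ ⟨x, ξ, rfl⟩
      have := congrArg (fun S : ↥M => (S : H →L[ℂ] H) ξ) (h x)
      rw [mul_assoc] at this
      exact this) _ (he2 x)
    exact this

/-- The sesquilinear form of an operator, as a point of a product space. -/
def formMap (T : H →L[ℂ] H) : H × H → ℂ := fun z => ⟪z.1, T z.2⟫

theorem formMap_injective : Function.Injective (formMap (H := H)) := by
  intro S T h
  refine ContinuousLinearMap.ext fun y => ext_inner_left ℂ fun x => ?_
  exact congrFun h (x, y)

theorem exists_formMap (F : H × H → ℂ) (hb : ∀ x y, ‖F (x, y)‖ ≤ ‖x‖ * ‖y‖)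
    (ha : ∀ x x' y, F (x + x', y) = F (x, y) + F (x', y))
    (hs : ∀ (c : ℂ) x y, F (c • x, y) = conj c * F (x, y))
    (ha' : ∀ x y y', F (x, y + y') = F (x, y) + F (x, y'))
    (hs' : ∀ (c : ℂ) x y, F (x, c • y) = c * F (x, y)) :
    ∃ T : H →L[ℂ] H, ‖T‖ ≤ 1 ∧ formMap T = F := by
  let B : H →L⋆[ℂ] H →L[ℂ] ℂ := LinearMap.mkContinuous₂
    (LinearMap.mk₂'ₛₗ (starRingEnd ℂ) (RingHom.id ℂ) (fun x y => F (x, y)) ha hs ha' hs') 1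
    (by intro x y; simpa using hb x y)
  let T : H →L[ℂ] H := ContinuousLinearMap.adjoint (InnerProductSpace.continuousLinearMapOfBilin B)
  have hT : ∀ x y, ⟪x, T y⟫ = F (x, y) := by
    intro x y
    rw [ContinuousLinearMap.adjoint_inner_right,
      InnerProductSpace.continuousLinearMapOfBilin_apply]
    rfl
  refine ⟨T, ?_, funext fun z => hT z.1 z.2⟩
  refine ContinuousLinearMap.opNorm_le_bound _ zero_le_one fun y => ?_
  rw [one_mul]
  by_contra! hlt
  have h1 := hb (T y) y
  rw [← hT, inner_self_eq_norm_sq_to_K] at h1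
  simp at h1
  nlinarith [norm_nonneg y]

/-- The compact convex set of contractions in `q M p`. -/
def ballSet (p q : ↥M) : Set (H →L[ℂ] H) :=
  {T | T ∈ M ∧ ‖T‖ ≤ 1 ∧ (q : H →L[ℂ] H) * T = T ∧ T * (p : H →L[ℂ] H) = T}

theorem isCompact_ballSet (p q : ↥M) (hq : star q = q) :
    IsCompact (formMap '' ballSet p q) := by
  have hq' : ∀ x y, ⟪(q : H →L[ℂ] H) x, y⟫ = ⟪x, (q : H →L[ℂ] H) y⟫ := by
    intro x y
    have : ContinuousLinearMap.adjoint (q : H →L[ℂ] H) = q := congrArg Subtype.val hq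
    rw [← ContinuousLinearMap.adjoint_inner_right, this]
  have hE : formMap '' ballSet p q = {F : H × H → ℂ |
      (∀ x y, ‖F (x, y)‖ ≤ ‖x‖ * ‖y‖) ∧
      (∀ x x' y, F (x + x', y) = F (x, y) + F (x', y)) ∧
      (∀ (c : ℂ) x y, F (c • x, y) = conj c * F (x, y)) ∧
      (∀ x y y', F (x, y + y') = F (x, y) + F (x, y')) ∧
      (∀ (c : ℂ) x y, F (x, c • y) = c * F (x, y)) ∧
      (∀ T ∈ M.commutant, ∀ x y, F (ContinuousLinearMap.adjoint T x, y) = F (x, T y)) ∧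
      (∀ x y, F ((q : H →L[ℂ] H) x, y) = F (x, y)) ∧
      (∀ x y, F (x, (p : H →L[ℂ] H) y) = F (x, y))} := by
    ext F
    constructor
    · rintro ⟨T, ⟨hTM, hT1, hqT, hTp⟩, rfl⟩
      refine ⟨?_, ?_, ?_, ?_, ?_, ?_, ?_, ?_⟩
      · intro x y
        refine (norm_inner_le_norm _ _).trans ?_
        gcongr
        simpa using T.le_of_opNorm_le hT1 y
      · intro x x' y; exact inner_add_left _ _ _
      · intro c x y; exact inner_smul_left _ _ _
      · intro x y y'; simp [formMap, inner_add_right]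
      · intro c x y; simp [formMap, inner_smul_right]
      · intro S hS x y
        simp only [formMap]
        rw [ContinuousLinearMap.adjoint_inner_left, vN_commute ⟨T, hTM⟩ hS]
      · intro x y
        simp only [formMap]
        rw [hq']
        exact congrArg (fun S : H →L[ℂ] H => ⟪x, S y⟫) hqT
      · intro x y
        exact congrArg (fun S : H →L[ℂ] H => ⟪x, S y⟫) hTp
    · rintro ⟨h1, h2, h3, h4, h5, h6, h7, h8⟩
      obtain ⟨T, hT1, rfl⟩ := exists_formMap F h1 h2 h3 h4 h5
      refine ⟨T, ⟨?_, hT1, ?_, ?_⟩, rfl⟩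
      · refine mem_of_commute fun S hS => ContinuousLinearMap.ext fun y => ext_inner_left ℂ fun x => ?_
        have := h6 S hS x y
        simp only [formMap, ContinuousLinearMap.adjoint_inner_left] at this
        exact this
      · refine ContinuousLinearMap.ext fun y => ext_inner_left ℂ fun x => ?_
        have := h7 x y
        simp only [formMap, hq'] at this
        exact this
      · exact ContinuousLinearMap.ext fun y => ext_inner_left ℂ fun x => h8 x y
  have hc : IsClosed (formMap '' ballSet p q) := by
    rw [hE]
    simp only [Set.ofPred_and, Set.ofPred_forall]
    refine IsClosed.inter ?_ (IsClosed.inter ?_ (IsClosed.inter ?_ (IsClosed.inter ?_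
      (IsClosed.inter ?_ (IsClosed.inter ?_ (IsClosed.inter ?_ ?_)))))) <;>
    repeat' first
      | refine isClosed_iInter fun _ => ?_
      | exact isClosed_eq (by fun_prop) (by fun_prop)
      | exact isClosed_le (by fun_prop) (by fun_prop)
  refine IsCompact.of_isClosed_subset
    (isCompact_univ_pi (s := fun z : H × H => Metric.closedBall (0 : ℂ) (‖z.1‖ * ‖z.2‖))
      fun z => isCompact_closedBall _ _) hc ?_
  rw [hE]
  rintro F ⟨h1, -⟩ z -
  simpa using h1 z.1 z.2

theorem exists_extreme (p q : ↥M) (hq : star q = q) :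
    ∃ v : ↥M, ‖v‖ ≤ 1 ∧ q * v = v ∧ v * p = v ∧
      ∀ w : ↥M, q * w = w → w * p = w → ‖v + w‖ ≤ 1 → ‖v - w‖ ≤ 1 → w = 0 := by
  have hne : (formMap '' ballSet p q).Nonempty :=
    ⟨_, 0, ⟨zero_mem _, by simp, by simp, by simp⟩, rfl⟩
  obtain ⟨_, ⟨v, ⟨hvM, hv1, hqv, hvp⟩, rfl⟩, hext⟩ :=
    (isCompact_ballSet p q hq).extremePoints_nonempty (E := H × H → ℂ) hne
  refine ⟨⟨v, hvM⟩, hv1, Subtype.ext hqv, Subtype.ext hvp, ?_⟩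
  intro w hqw hwp h1 h2
  have m1 : formMap (v + (w : H →L[ℂ] H)) ∈ formMap '' ballSet p q :=
    ⟨_, ⟨add_mem hvM w.2, h1, by rw [mul_add, hqv]; congr 1; exact congrArg Subtype.val hqw,
      by rw [add_mul, hvp]; congr 1; exact congrArg Subtype.val hwp⟩, rfl⟩
  have m2 : formMap (v - (w : H →L[ℂ] H)) ∈ formMap '' ballSet p q :=
    ⟨_, ⟨sub_mem hvM w.2, h2, by rw [mul_sub, hqv]; congr 1; exact congrArg Subtype.val hqw,
      by rw [sub_mul, hvp]; congr 1; exact congrArg Subtype.val hwp⟩, rfl⟩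
  have := hext m1 m2 (by
    refine ⟨1/2, 1/2, by norm_num, by norm_num, by norm_num, ?_⟩
    funext z
    simp only [formMap, Pi.add_apply, Pi.smul_apply, ContinuousLinearMap.add_apply,
      ContinuousLinearMap.sub_apply, inner_add_right, inner_sub_right, Complex.real_smul]
    push_cast
    ring)
  have h3 := formMap_injective this
  exact Subtype.ext (by simpa using h3)

section CS
variable {A : Type*} [CStarAlgebra A] [PartialOrder A] [StarOrderedRing A]

theorem norm_le_one_of_star_mul_le {x : A} (h : star x * x ≤ 1) : ‖x‖ ≤ 1 := by
  have h1 := (CStarAlgebra.norm_le_one_iff_of_nonneg (star x * x) (star_mul_self_nonneg x)).mpr h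
  rw [CStarRing.norm_star_mul_self] at h1
  nlinarith [norm_nonneg x]

theorem star_mul_le_one {x : A} (h : ‖x‖ ≤ 1) : star x * x ≤ 1 := by
  rw [← CStarAlgebra.norm_le_one_iff_of_nonneg (star x * x) (star_mul_self_nonneg x),
    CStarRing.norm_star_mul_self]
  nlinarith [norm_nonneg x]

theorem norm_le_of_between {x : A} {r : ℝ} (hr : 0 ≤ r) (h1 : -(algebraMap ℝ A r) ≤ x)
    (h2 : x ≤ algebraMap ℝ A r) : ‖x‖ ≤ r := by
  have a1 : 0 ≤ algebraMap ℝ A r + x := by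
    have := sub_nonneg.mpr h1; rwa [sub_neg_eq_add, add_comm] at this
  have a2 : 0 ≤ algebraMap ℝ A r - x := sub_nonneg.mpr h2
  have hxs : IsSelfAdjoint x := by
    have h3 : IsSelfAdjoint (algebraMap ℝ A r) := IsSelfAdjoint.algebraMap A (by simp [IsSelfAdjoint])
    have := a1.isSelfAdjoint.sub h3
    simpa using this
  have hc : Commute (algebraMap ℝ A r + x) (algebraMap ℝ A r - x) := by
    have hcr : Commute (algebraMap ℝ A r) x := Algebra.commutes r x
    exact ((Commute.refl _).sub_right hcr).add_left (hcr.symm.sub_right (Commute.refl _))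
  have h4 := hc.mul_nonneg a1 a2
  have e : (algebraMap ℝ A r + x) * (algebraMap ℝ A r - x) = algebraMap ℝ A (r ^ 2) - star x * x := by
    rw [hxs.star_eq, mul_sub, add_mul, add_mul, ← Algebra.commutes r x, pow_two, map_mul]
    abel
  rw [e, sub_nonneg] at h4
  have h5 := (CStarAlgebra.norm_le_iff_le_algebraMap (star x * x) (sq_nonneg r)
    (star_mul_self_nonneg x)).mpr h4
  rw [CStarRing.norm_star_mul_self] at h5
  nlinarith [norm_nonneg x]

/-- Comparison: a maximal partial isometry in `q M p`. -/
theorem pi_of_extreme (p q : A) (hp : star p = p) (hpp : p * p = p) (hq : star q = q)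
    (hqq : q * q = q) (v : A) (hv1 : ‖v‖ ≤ 1) (hqv : q * v = v) (hvp : v * p = v)
    (hext : ∀ w : A, q * w = w → w * p = w → ‖v + w‖ ≤ 1 → ‖v - w‖ ≤ 1 → w = 0) :
    v * (star v * v) = v ∧
      ∀ x : A, (q - v * star v) * x * (p - star v * v) = 0 := by
  have hvs : p * star v = star v := by simpa [hp] using congrArg star hvp
  have hvq : star v * q = star v := by simpa [hq] using congrArg star hqv
  have hp1 : p ≤ 1 := by
    have h0 : 0 ≤ star (1 - p) * (1 - p) := star_mul_self_nonneg _
    have : star (1 - p) * (1 - p) = 1 - p := by simp [hp, mul_sub, sub_mul, hpp]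
    rw [this] at h0
    exact sub_nonneg.mp h0
  have hs1 : star v * v ≤ 1 := star_mul_le_one hv1
  obtain ⟨s, hs⟩ : ∃ s, s = star v * v := ⟨_, rfl⟩
  have hss : star s = s := by simp [hs]
  have hs0 : 0 ≤ s := hs ▸ star_mul_self_nonneg v
  rw [← hs] at hs1
  have hsp : s * p = s := by rw [hs, mul_assoc, hvp]
  have hvss : v * s = v := by
    have h1s : 0 ≤ 1 - s := sub_nonneg.mpr hs1
    have hh : (1/2 : ℝ) • (v - v * s) = 0 := by
      refine hext _ ?_ ?_ ?_ ?_
      · rw [mul_smul_comm, mul_sub, ← mul_assoc, hqv]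
      · rw [smul_mul_assoc, sub_mul, mul_assoc, hsp, hvp]
      · apply norm_le_one_of_star_mul_le
        have e : star (v + (1/2 : ℝ) • (v - v * s)) * (v + (1/2 : ℝ) • (v - v * s))
            = 1 - (star (1 - s) * (1 - (1/4 : ℝ) • s) * (1 - s)) := by
          have e1 : v + (1/2 : ℝ) • (v - v * s) = v * (((3/2 : ℝ)) • 1 - (1/2 : ℝ) • s) := by
            rw [mul_sub, mul_smul_comm, mul_smul_comm, mul_one]
            module
          rw [e1, star_mul, mul_assoc, ← mul_assoc (star v), ← hs]
          simp only [star_sub, star_one, hss, star_smul, star_trivial, sub_mul, mul_sub, mul_one,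
            one_mul, smul_mul_assoc, mul_smul_comm, smul_sub, smul_smul, mul_assoc]
          module
        rw [e]
        refine sub_le_self _ (star_left_conjugate_nonneg ?_ _)
        have : (1 : A) - (1/4 : ℝ) • s = (1 - s) + (3/4 : ℝ) • s := by module
        rw [this]
        exact add_nonneg h1s (smul_nonneg (by norm_num) hs0)
      · have e1 : v - (1/2 : ℝ) • (v - v * s) = (1/2 : ℝ) • v + (1/2 : ℝ) • (v * s) := by module
        rw [e1]
        have n1 : ‖s‖ ≤ 1 := by
          rw [hs, CStarRing.norm_star_mul_self]; nlinarith [norm_nonneg v]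
        have n2 : ‖v * s‖ ≤ 1 := (norm_mul_le _ _).trans (by nlinarith [norm_nonneg v, norm_nonneg s])
        refine (norm_add_le _ _).trans ?_
        rw [norm_smul, norm_smul]
        rw [Real.norm_of_nonneg (by norm_num)]
        linarith
    have : v - v * s = (2 : ℝ) • ((1/2 : ℝ) • (v - v * s)) := by module
    rw [hh, smul_zero] at this
    exact (sub_eq_zero.mp this).symm
  have hs2 : s * s = s := by
    conv_lhs => rw [hs, mul_assoc, ← hs, hvss, ← hs]
  refine ⟨by rw [← hs, hvss], ?_⟩
  intro x
  rw [← hs]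
  have hsv : s * star v = star v := by simpa [hss] using congrArg star hvss
  have hps : p * s = s := by simpa [hp, hss] using congrArg star hsp
  obtain ⟨y, hy⟩ : ∃ y, y = (q - v * star v) * x * (p - s) := ⟨_, rfl⟩
  have hfs : star (p - s) = p - s := by simp [hp, hss]
  have hff : (p - s) * (p - s) = p - s := by
    simp only [mul_sub, sub_mul, hpp, hps, hsp, hs2]; abel
  have hyf : y * (p - s) = y := by rw [hy, mul_assoc, hff]
  have hvg : star v * (q - v * star v) = 0 := by
    rw [mul_sub, hvq, ← mul_assoc, ← hs, hsv, sub_self]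
  have hvy : star v * y = 0 := by rw [hy, mul_assoc, ← mul_assoc (star v), hvg, zero_mul]
  have hyv : star y * v = 0 := by simpa using congrArg star hvy
  have hqy : q * y = y := by
    have : q * (q - v * star v) = q - v * star v := by rw [mul_sub, hqq, ← mul_assoc, hqv]
    rw [hy, mul_assoc, ← mul_assoc q, this]
  have hyp : y * p = y := by
    have : (p - s) * p = p - s := by rw [sub_mul, hpp, hsp]
    rw [hy, mul_assoc, this]
  rw [← hy]
  obtain ⟨c, hc0, hc⟩ : ∃ c : ℝ, c ≠ 0 ∧ ‖c • y‖ ≤ 1 := by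
    have h0 : 0 < ‖y‖ + 1 := by positivity
    refine ⟨(‖y‖ + 1)⁻¹, by positivity, ?_⟩
    rw [norm_smul, Real.norm_of_nonneg (by positivity), inv_mul_le_iff₀ h0]
    linarith
  have hle : star (c • y) * (c • y) ≤ p - s := by
    have := star_mul_self_le_of hfs hff (star_mul_le_one hc)
    refine le_of_eq_of_le ?_ this
    have e1 : (c • y) * (p - s) = c • y := by rw [smul_mul_assoc, hyf]
    have e2 : (p - s) * star (c • y) = star (c • y) := by 
      have := congrArg star e1
      rwa [star_mul, hfs] at this
    rw [← mul_assoc, e2, mul_assoc, e1]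
  have hcv : star (c • y) * v = 0 := by rw [star_smul, smul_mul_assoc, hyv, smul_zero]
  have hz : c • y = 0 := by
    refine hext _ (by rw [mul_smul_comm, hqy]) (by rw [smul_mul_assoc, hyp]) ?_ ?_
    · apply norm_le_one_of_star_mul_le
      have e : star (v + c • y) * (v + c • y) = s + star (c • y) * (c • y) := by
        rw [star_add, hs, add_mul, mul_add, mul_add, mul_smul_comm, hvy, hcv]
        simp
      rw [e]
      calc s + star (c • y) * (c • y) ≤ s + (p - s) := by gcongr
        _ = p := by abel
        _ ≤ 1 := hp1
    · apply norm_le_one_of_star_mul_le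
      have e : star (v - c • y) * (v - c • y) = s + star (c • y) * (c • y) := by
        rw [star_sub, hs, sub_mul, mul_sub, mul_sub, mul_smul_comm, hvy, hcv]
        simp
      rw [e]
      calc s + star (c • y) * (c • y) ≤ s + (p - s) := by gcongr
        _ = p := by abel
        _ ≤ 1 := hp1
  have : y = c⁻¹ • (c • y) := by rw [smul_smul, inv_mul_cancel₀ hc0, one_smul]
  rw [this, hz, smul_zero]

theorem proj_le_one {p : A} (hp : star p = p) (hpp : p * p = p) : p ≤ 1 := by
  have h0 : 0 ≤ star (1 - p) * (1 - p) := star_mul_self_nonneg _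
  have : star (1 - p) * (1 - p) = 1 - p := by simp [hp, mul_sub, sub_mul, hpp]
  rw [this] at h0
  exact sub_nonneg.mp h0

theorem proj_nonneg {p : A} (hp : star p = p) (hpp : p * p = p) : 0 ≤ p := by
  have h0 : 0 ≤ star p * p := star_mul_self_nonneg _
  rwa [hp, hpp] at h0

theorem proj_sub_nonneg {e f : A} (he : star e = e) (hee : e * e = e) (hf : star f = f)
    (hff : f * f = f) (hef : e * f = f) : 0 ≤ e - f := by
  have hfe : f * e = f := by simpa [he, hf] using congrArg star hef
  refine proj_nonneg (by rw [star_sub, he, hf]) ?_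
  rw [mul_sub, sub_mul, sub_mul, hee, hfe, hef, hff]
  abel

/-- The averaging estimate. -/
theorem averaging_step (h p v e : A) (hp : star p = p) (hpp : p * p = p) (hhp : h ≤ p)
    (hph : -(1 - p) ≤ h) (hqv : (1 - p) * v = v) (hvp : v * p = v)
    (hvv : v * (star v * v) = v) (he : star e = e) (hee : e * e = e) (hec : ∀ a, e * a = a * e)
    (hep : e * (p - star v * v) = p - star v * v) (hqe : (1 - p - v * star v) * e = 0) :
    ∃ u : A, star u = u ∧ u * u = 1 ∧
      ‖h + u * h * u - (e - (1/2 : ℝ) • 1)‖ ≤ 3 / 2 := by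
  have hpv : p * v = 0 := by
    rw [sub_mul, one_mul, sub_eq_self] at hqv; exact hqv
  obtain ⟨w, hw⟩ : ∃ w, w = star v := ⟨_, rfl⟩
  have hws : star w = v := by rw [hw, star_star]
  rw [← hw] at hvv hep hqe
  have hwp : w * p = 0 := by simpa [hp, ← hw] using congrArg star hpv
  have hpw : p * w = w := by simpa [hp, ← hw] using congrArg star hvp
  have hvv0 : v * v = 0 := by
    nth_rw 1 [← hvp]; rw [mul_assoc, hpv, mul_zero]
  have hww0 : w * w = 0 := by
    nth_rw 2 [← hpw]; rw [← mul_assoc, hwp, zero_mul]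
  have hwvw : w * v * w = w := by simpa [← hw, hws, mul_assoc] using congrArg star hvv
  have hvwv : v * w * v = v := by rw [mul_assoc, hvv]
  -- extended rewriting rules
  have a1 : ∀ x, p * (v * x) = 0 := fun x => by rw [← mul_assoc, hpv, zero_mul]
  have a2 : ∀ x, w * (p * x) = 0 := fun x => by rw [← mul_assoc, hwp, zero_mul]
  have a3 : ∀ x, p * (w * x) = w * x := fun x => by rw [← mul_assoc, hpw]
  have a4 : ∀ x, v * (p * x) = v * x := fun x => by rw [← mul_assoc, hvp]
  have a5 : ∀ x, v * (v * x) = 0 := fun x => by rw [← mul_assoc, hvv0, zero_mul]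
  have a6 : ∀ x, w * (w * x) = 0 := fun x => by rw [← mul_assoc, hww0, zero_mul]
  have a7 : ∀ x, w * (v * (w * x)) = w * x := fun x => by
    rw [← mul_assoc, ← mul_assoc, hwvw]
  have a8 : ∀ x, v * (w * (v * x)) = v * x := fun x => by
    rw [← mul_assoc, ← mul_assoc, hvwv]
  have a9 : w * (v * w) = w := by rw [← mul_assoc, hwvw]
  have a10 : ∀ x, p * (p * x) = p * x := fun x => by rw [← mul_assoc, hpp]
  obtain ⟨u, hu⟩ : ∃ u, u = v + w + 1 - w * v - v * w := ⟨_, rfl⟩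
  have hus : star u = u := by
    rw [hu]; simp only [star_sub, star_add, star_mul, star_one, hws, ← hw]; abel
  have huu : u * u = 1 := by
    rw [hu]
    simp only [mul_sub, sub_mul, mul_add, add_mul, mul_one, one_mul, mul_assoc, a5, a6, a7, a8, a9,
      hvv, hvv0, hww0, mul_zero]
    abel
  have hup : u * p * u = v * w + p - w * v := by
    rw [hu]
    simp only [mul_sub, sub_mul, mul_add, add_mul, mul_one, one_mul, mul_assoc, a1, a2, a3, a4, a5,
      a6, a7, a8, a9, hvv, hvv0, hww0, hpp, hpv, hvp, hwp, hpw, mul_zero]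
    abel
  have hq1 : 1 - p - v * w ≥ 0 := by
    have hs : star (1 - p - v * w) = 1 - p - v * w := by simp [hp, hws, ← hw]
    refine proj_nonneg hs ?_
    simp only [mul_sub, sub_mul, mul_one, one_mul, mul_assoc, a1, a9, a8, hwp, hpp, mul_zero]
    abel
  have hps : p - w * v ≥ 0 := by
    have hs : star (p - w * v) = p - w * v := by simp [hp, hws, ← hw]
    refine proj_nonneg hs ?_
    simp only [mul_sub, sub_mul, mul_assoc, a3, a7, hvp, hvv, hpp]
    abel
  have hpws : star (p - w * v) = p - w * v := by simp [hp, hws, ← hw]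
  have hpww : (p - w * v) * (p - w * v) = p - w * v := by
    simp only [mul_sub, sub_mul, mul_assoc, a3, a7, hvp, hvv, hpp]
    abel
  have hqws : star (1 - p - v * w) = 1 - p - v * w := by simp [hp, hws, ← hw]
  have hqww : (1 - p - v * w) * (1 - p - v * w) = 1 - p - v * w := by
    simp only [mul_sub, sub_mul, mul_one, one_mul, mul_assoc, a1, a9, a8, hwp, hpp, mul_zero]
    abel
  have he1 : 0 ≤ e - (p - w * v) := by
    exact proj_sub_nonneg he hee hpws hpww hep
  have he2 : 0 ≤ (1 - e) - (1 - p - v * w) := by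
    have h4 : (1 - e) * (1 - p - v * w) = 1 - p - v * w := by
      rw [sub_mul, hec, hqe, one_mul, sub_zero]
    exact proj_sub_nonneg (by simp [he]) (by simp [mul_sub, sub_mul, hee]) hqws hqww h4
  refine ⟨u, hus, huu, ?_⟩
  have b1 : u * h * u ≤ v * w + p - w * v := by
    rw [← hup]
    have := star_left_conjugate_le_conjugate hhp u
    rwa [hus] at this
  have b2 : -(1 - (v * w + p - w * v)) ≤ u * h * u := by
    have := star_left_conjugate_le_conjugate hph u
    rw [hus] at this
    refine le_of_eq_of_le ?_ this
    rw [mul_neg, neg_mul, mul_sub, sub_mul, hup, mul_one, huu]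
  refine norm_le_of_between (by norm_num) ?_ ?_
  · rw [Algebra.algebraMap_eq_smul_one, ← sub_nonneg]
    have e : h + u * h * u - (e - (1/2 : ℝ) • 1) - -((3/2 : ℝ) • (1 : A)) =
      (h - -(1 - p)) + (u * h * u - -(1 - (v * w + p - w * v))) + (p - w * v)
        + ((1 - e) - (1 - p - v * w)) := by module
    rw [e]
    exact add_nonneg (add_nonneg (add_nonneg (sub_nonneg.mpr hph) (sub_nonneg.mpr b2)) hps) he2
  · rw [Algebra.algebraMap_eq_smul_one, ← sub_nonneg]
    have e : (3/2 : ℝ) • (1 : A) - (h + u * h * u - (e - (1/2 : ℝ) • 1)) =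
      (p - h) + (v * w + p - w * v - u * h * u) + (1 - p - v * w) + (e - (p - w * v)) := by module
    rw [e]
    exact add_nonneg (add_nonneg (add_nonneg (sub_nonneg.mpr hhp) (sub_nonneg.mpr b1)) hq1) he1

end CS

/-- One averaging step for contractions. -/
theorem averaging_one (h : ↥M) (hh : IsSelfAdjoint h) (hn : ‖h‖ ≤ 1) :
    ∃ u : ↥M, star u = u ∧ u * u = 1 ∧ ∃ c ∈ Set.center ↥M, IsSelfAdjoint c ∧
      ‖(1/2 : ℝ) • (h + u * h * u) - c‖ ≤ 3 / 4 := by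
  obtain ⟨p, hp, hpp, hhp, hph⟩ := exists_cut h hh hn
  have hq : star (1 - p) = 1 - p := by rw [star_sub, star_one, hp]
  have hqq : (1 - p) * (1 - p) = 1 - p := by
    rw [mul_sub, sub_mul, sub_mul, hpp]; simp
  obtain ⟨v, hv1, hqv, hvp, hext⟩ := exists_extreme p (1 - p) hq
  obtain ⟨hvv, hx⟩ := pi_of_extreme p (1 - p) hp hpp hq hqq v hv1 hqv hvp hext
  obtain ⟨e, hec, he, hee, hep, hqe⟩ := exists_central _ _ hx
  obtain ⟨u, hus, huu, hu⟩ := averaging_step h p v e hp hpp hhp hph hqv hvp hvv he hee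
    (mem_center_iff'.mp hec) hep hqe
  refine ⟨u, hus, huu, (1/2 : ℝ) • (e - (1/2 : ℝ) • 1), ?_, ?_, ?_⟩
  · rw [mem_center_iff']
    intro a
    have := mem_center_iff'.mp hec a
    rw [smul_mul_assoc, mul_smul_comm, sub_mul, mul_sub, this, smul_mul_assoc, mul_smul_comm,
      one_mul, mul_one]
  · have h1 : IsSelfAdjoint e := he
    have h2 : IsSelfAdjoint (1 : ↥M) := .one _
    exact (IsSelfAdjoint.all (1/2 : ℝ)).smul (h1.sub ((IsSelfAdjoint.all (1/2 : ℝ)).smul h2))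
  · rw [← smul_sub, norm_smul, Real.norm_of_nonneg (by norm_num)]
    linarith

theorem averaging_gen (h : ↥M) (hh : IsSelfAdjoint h) :
    ∃ u : ↥M, star u = u ∧ u * u = 1 ∧ ∃ c ∈ Set.center ↥M, IsSelfAdjoint c ∧
      ‖(1/2 : ℝ) • (h + u * h * u) - c‖ ≤ 3 / 4 * ‖h‖ := by
  by_cases h0 : ‖h‖ = 0
  · refine ⟨1, star_one _, one_mul _, 0, Set.zero_mem_center, .zero _, ?_⟩
    have : h = 0 := norm_eq_zero.mp h0
    rw [this]; simp
  have hpos : 0 < ‖h‖ := lt_of_le_of_ne (norm_nonneg _) (Ne.symm h0)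
  have hn : ‖(‖h‖⁻¹ : ℝ) • h‖ ≤ 1 := by
    rw [norm_smul, norm_inv, norm_norm, inv_mul_cancel₀ h0]
  obtain ⟨u, hus, huu, c, hc, hcs, hle⟩ := averaging_one ((‖h‖⁻¹ : ℝ) • h)
    ((IsSelfAdjoint.all _).smul hh) hn
  refine ⟨u, hus, huu, (‖h‖ : ℝ) • c, ?_, (IsSelfAdjoint.all _).smul hcs, ?_⟩
  · rw [mem_center_iff']
    intro a
    rw [smul_mul_assoc, mul_smul_comm, mem_center_iff'.mp hc]
  · have e : (1/2 : ℝ) • (h + u * h * u) - (‖h‖ : ℝ) • c = (‖h‖ : ℝ) •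
        ((1/2 : ℝ) • ((‖h‖⁻¹ : ℝ) • h + u * ((‖h‖⁻¹ : ℝ) • h) * u) - c) := by
      have h1 : h = (‖h‖ : ℝ) • (‖h‖⁻¹ : ℝ) • h := by
        rw [smul_smul, mul_inv_cancel₀ h0, one_smul]
      generalize (‖h‖⁻¹ : ℝ) • h = k at h1 ⊢
      generalize ‖h‖ = r at h1 ⊢
      subst h1
      rw [mul_smul_comm, smul_mul_assoc]
      module
    rw [e, norm_smul, norm_norm, mul_comm]
    gcongr

theorem ucp_conj (u : ↥M) (hu : star u * u = 1) :
    ∃ ψ : ↥M →L[ℂ] ↥M, IsElementaryUCP ψ ∧ ∀ x, ψ x = star u * x * u := by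
  refine ⟨elemMap (fun _ : Fin 1 => u), elemMap_ucp _ (by simpa using hu), fun x => ?_⟩
  rw [elemMap_apply, Fin.sum_univ_one]

theorem ucp_average (u : ↥M) (hus : star u = u) (huu : u * u = 1) :
    ∃ ψ : ↥M →L[ℂ] ↥M, IsElementaryUCP ψ ∧ ∀ x, ψ x = (1/2 : ℝ) • (x + u * x * u) := by
  obtain ⟨ψ, hψ, h1⟩ := ucp_conj (1 : ↥M) (by simp)
  obtain ⟨χ, hχ, h2⟩ := ucp_conj u (by rw [hus, huu])
  refine ⟨_, hψ.convex hχ (s := 1/2) (t := 1/2) (by norm_num) (by norm_num) (by norm_num), ?_⟩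
  intro x
  rw [ContinuousLinearMap.add_apply, ContinuousLinearMap.smul_apply, ContinuousLinearMap.smul_apply,
    h1, h2, hus, ← smul_add, star_one, one_mul, mul_one]
  exact Complex.coe_smul _ _

/-- Dixmier averaging for self-adjoint elements. -/
theorem dixmier (h : ↥M) (hh : IsSelfAdjoint h) (n : ℕ) :
    ∃ ψ : ↥M →L[ℂ] ↥M, IsElementaryUCP ψ ∧
      (∀ τ : ↥M →L[ℂ] ℂ, (∀ x y : ↥M, τ (x * y) = τ (y * x)) → ∀ x, τ (ψ x) = τ x) ∧
      ∃ c ∈ Set.center ↥M, IsSelfAdjoint c ∧ ‖ψ h - c‖ ≤ (3 / 4) ^ n * ‖h‖ := by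
  induction n with
  | zero =>
    obtain ⟨ψ, hψ, h1⟩ := ucp_conj (1 : ↥M) (by simp)
    have h2 : ∀ x, ψ x = x := fun x => by rw [h1, star_one, one_mul, mul_one]
    refine ⟨ψ, hψ, fun τ _ x => by rw [h2], 0, Set.zero_mem_center, .zero _, ?_⟩
    rw [h2]; simp
  | succ n ih =>
    obtain ⟨ψ, hψ, hτ, c, hc, hcs, hle⟩ := ih
    obtain ⟨u, hus, huu, d, hd, hds, hle2⟩ := averaging_gen (ψ h - c) ((hψ.star hh).sub hcs)
    obtain ⟨β, hβ, hβ1⟩ := ucp_average u hus huu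
    refine ⟨β.comp ψ, hβ.comp hψ, ?_, c + d, Set.add_mem_center hc hd, hcs.add hds, ?_⟩
    · intro τ ht x
      have e : τ (u * ψ x * u) = τ (ψ x) := by
        rw [ht, ← mul_assoc, huu, one_mul]
      have e2 : β (ψ x) = ((1/2 : ℝ) : ℂ) • (ψ x + u * ψ x * u) := by
        rw [hβ1]; exact (Complex.coe_smul _ _).symm
      rw [ContinuousLinearMap.comp_apply, e2, map_smul, map_add, e, hτ τ ht, smul_eq_mul]
      push_cast
      ring
    · rw [← hβ1, map_sub, hβ.center hc, sub_sub] at hle2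
      rw [ContinuousLinearMap.comp_apply]
      refine hle2.trans ?_
      rw [pow_succ]
      linarith

theorem part_two (τ : ↥M →L[ℂ] ℂ) (hτ : IsState τ) (htr : ∀ x y : ↥M, τ (x * y) = τ (y * x)) :
    IsMaximallyMixed τ := by
  refine ⟨hτ, fun ρ hρ hcl => inClosure_of_sep ρ τ hρ hτ fun h hh ε hε => ?_⟩
  have ht : Filter.Tendsto (fun n : ℕ => (‖τ‖ + ‖ρ‖) * ((3 / 4 : ℝ) ^ n * ‖h‖)) Filter.atTop
      (nhds ((‖τ‖ + ‖ρ‖) * (0 * ‖h‖))) :=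
    ((tendsto_pow_atTop_nhds_zero_of_lt_one (by norm_num) (by norm_num)).mul_const _).const_mul _
  rw [zero_mul, mul_zero] at ht
  obtain ⟨n, hn⟩ := (ht.eventually_lt_const hε).exists
  obtain ⟨ψ, hψ, hinv, c, hc, -, hle⟩ := dixmier h hh n
  refine ⟨ψ, hψ, ?_⟩
  have e : τ h - ρ (ψ h) = τ (ψ h - c) - ρ (ψ h - c) := by
    rw [map_sub, map_sub, hinv τ htr, eq_on_center hcl hc]; ring
  have h1 : (τ h - ρ (ψ h)).re ≤ (‖τ‖ + ‖ρ‖) * ((3 / 4 : ℝ) ^ n * ‖h‖) := by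
    refine (Complex.re_le_norm _).trans ?_
    rw [e]
    refine (norm_sub_le _ _).trans ?_
    rw [add_mul]
    exact add_le_add (τ.le_opNorm_of_le hle) (ρ.le_opNorm_of_le hle)
  rw [Complex.sub_re] at h1
  linarith

end Helpers

/-- **Corollary.** Let `ω = μ ∘ φ` be a state on `M`, where `μ = ω|Z` and
`φ : M → Z` is a unital positive `Z`-module map.  If `φ(M_t) ⊆ t` for every
maximal ideal `t` of the center (with `M_t` the unique maximal ideal of `M`
containing `t`), then `ω` is maximally mixed.  In particular every tracial
state on `M` is maximally mixed. -/
theorem maximallyMixed_of_factorization_and_tracial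
    (ω : ↥M →L[ℂ] ℂ) (hω : IsState ω)
    (φ : ↥M →L[ℂ] ↥M)
    (hrange : ∀ x : ↥M, φ x ∈ Set.center ↥M)
    (hpos : ∀ a : ↥M, ∃ b : ↥M, φ (star a * a) = star b * b)
    (hone : φ 1 = 1)
    (hmod : ∀ z ∈ Set.center ↥M, ∀ x : ↥M, φ (z * x) = z * φ x)
    (hfactor : ∀ x : ↥M, ω x = ω (φ x))
    (ht : ∀ t Mt : Set ↥M, IsMaxCenterIdeal t → IsMaximalIdeal Mt → t ⊆ Mt →
      ∀ x ∈ Mt, φ x ∈ t) :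
    IsMaximallyMixed ω ∧
      ∀ τ : ↥M →L[ℂ] ℂ, IsState τ → (∀ x y : ↥M, τ (x * y) = τ (y * x)) →
        IsMaximallyMixed τ := by
  exact ⟨part_one ω hω φ hrange hpos hone hmod hfactor ht, fun τ hτ htr => part_two τ hτ htr⟩

end VonNeumannAlgebraPaper

end
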